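/- arXiv:1902.03730 — 2 statements merged into one kernel-verified Lean document; each statement's English description precedes it below -/
import Mathlib

section
/- Let P ⊂ ℝ^k be a lattice polytope with respect to ℤ^k and let Q = conv({0} ∪ (P × {1})) ⊂ ℝ^{k+1} be the 1-fold standard pyramid over P. Then Q is very ample if and only if P is normal. -/
open Set MeasureTheory
open scoped Pointwise

/-- A point of `ℝ^n` is a lattice point if all its coordinates are integers. -/
def IsLatticePt {n : ℕ} (x : Fin n → ℝ) : Prop := ∀ i, ∃ z : ℤ, x i = (z : ℝ)

/-- The set of lattice points of a subset of `ℝ^n`. -/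
def latticePts {n : ℕ} (S : Set (Fin n → ℝ)) : Set (Fin n → ℝ) := {x ∈ S | IsLatticePt x}

/-- `P` is `k`-normal: every lattice point of the dilate `k • P` is a sum of `k`
lattice points of `P`. -/
def IsKNormal {n : ℕ} (P : Set (Fin n → ℝ)) (k : ℕ) : Prop :=
  ∀ x ∈ latticePts ((k : ℝ) • P),
    ∃ u : Fin k → Fin n → ℝ, (∀ j, u j ∈ latticePts P) ∧ x = ∑ j, u j

/-- The `k`-normality `k_P`: the least positive integer such that `P` is `k`-normal for
all `k ≥ k_P`. -/
noncomputable def kNormality {n : ℕ} (P : Set (Fin n → ℝ)) : ℕ :=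
  sInf {m | 0 < m ∧ ∀ k, m ≤ k → IsKNormal P k}

/-- The real cone generated by a set `S` (for convex `S`, all nonnegative multiples of
points of `S`). -/
def coneOver {n : ℕ} (S : Set (Fin n → ℝ)) : Set (Fin n → ℝ) :=
  {x | ∃ t : ℝ, ∃ p ∈ S, 0 ≤ t ∧ x = t • p}

/-- `P` is very ample: for every vertex (= extreme point) `v` of `P`, every lattice point
of the real cone generated by `P - v` is a finite sum of elements of `(P ∩ M) - v`. -/
def IsVeryAmple {n : ℕ} (P : Set (Fin n → ℝ)) : Prop :=
  ∀ v ∈ P.extremePoints ℝ, ∀ x : Fin n → ℝ, IsLatticePt x →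
    x ∈ coneOver ((fun p => p - v) '' P) →
    ∃ (m : ℕ) (u : Fin m → Fin n → ℝ), (∀ j, u j ∈ latticePts P) ∧ x = ∑ j, (u j - v)

/-- The invariant `d_P`: the smallest positive integer such that
`(k+1)P ∩ M = (P ∩ M) + (kP ∩ M)` for all `k ≥ d_P`. -/
noncomputable def dInv {n : ℕ} (P : Set (Fin n → ℝ)) : ℕ :=
  sInf {m | 0 < m ∧ ∀ k : ℕ, m ≤ k →
    latticePts (((k : ℝ) + 1) • P) = latticePts P + latticePts ((k : ℝ) • P)}

/-- The invariant `ν_P` (relative to a set `V`, typically the vertex set of `P`): the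
smallest positive integer such that `(k+1)P ∩ M = V + (kP ∩ M)` for all `k ≥ ν_P`. -/
noncomputable def nuInv {n : ℕ} (V P : Set (Fin n → ℝ)) : ℕ :=
  sInf {m | 0 < m ∧ ∀ k : ℕ, m ≤ k →
    latticePts (((k : ℝ) + 1) • P) = V + latticePts ((k : ℝ) • P)}

/-- The normalized volume of `P ⊆ ℝ^n`: `n!` times its Euclidean (Lebesgue) volume. -/
noncomputable def nVol {n : ℕ} (P : Set (Fin n → ℝ)) : ℝ :=
  (n.factorial : ℝ) * (volume P).toReal

open Classical in
/-- The degree of a lattice `n`-polytope `P`: `n` if `P` has an interior lattice point,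
and otherwise the least `i ≥ 0` such that `(kP)° ∩ M = ∅` for all `1 ≤ k ≤ n - i`. -/
noncomputable def polyDeg {n : ℕ} (P : Set (Fin n → ℝ)) : ℕ :=
  if (latticePts (interior P)).Nonempty then n
  else sInf {i | ∀ k : ℕ, 1 ≤ k → k ≤ n - i → latticePts (interior ((k : ℝ) • P)) = ∅}

/-- `P` is a lattice polytope: the convex hull of finitely many lattice points. -/
def IsLatticePolytope {n : ℕ} (P : Set (Fin n → ℝ)) : Prop :=
  ∃ S : Finset (Fin n → ℝ), (∀ x ∈ S, IsLatticePt x) ∧ P = convexHull ℝ (S : Set (Fin n → ℝ))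

/-- `P` is normal: `t`-normal for every `t ≥ 1`. -/
def IsNormal {n : ℕ} (P : Set (Fin n → ℝ)) : Prop :=
  ∀ t : ℕ, 1 ≤ t → IsKNormal P t

/-- The 1-fold standard pyramid `conv({0} ∪ (P × {1})) ⊆ ℝ^(n+1)` over `P ⊆ ℝ^n`. -/
def pyramid {n : ℕ} (P : Set (Fin n → ℝ)) : Set (Fin (n + 1) → ℝ) :=
  convexHull ℝ (insert 0 ((fun x => Fin.snoc x (1 : ℝ)) '' P))

/-- The point `(p, 1)` at height one over `p`. -/
def heightOne {n : ℕ} (p : Fin n → ℝ) : Fin (n + 1) → ℝ := Fin.snoc p (1 : ℝ)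

@[simp] theorem heightOne_last {n : ℕ} (p : Fin n → ℝ) : heightOne p (Fin.last n) = 1 := by
  simp [heightOne]

@[simp] theorem heightOne_castSucc {n : ℕ} (p : Fin n → ℝ) (i : Fin n) :
    heightOne p i.castSucc = p i := by
  simp [heightOne]

theorem isLatticePt_zero {n : ℕ} : IsLatticePt (0 : Fin n → ℝ) := fun _ => ⟨0, by simp⟩

theorem IsLatticePt.heightOne {n : ℕ} {p : Fin n → ℝ} (hp : IsLatticePt p) :
    IsLatticePt (heightOne p) := by
  intro i
  refine Fin.lastCases ⟨1, by simp⟩ (fun i => ?_) i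
  simpa using hp i

theorem IsLatticePt.add_nsmul {n : ℕ} {x w : Fin n → ℝ} (hx : IsLatticePt x)
    (hw : IsLatticePt w) (N : ℕ) : IsLatticePt (x + (N : ℝ) • w) := by
  intro i
  obtain ⟨a, ha⟩ := hx i
  obtain ⟨b, hb⟩ := hw i
  exact ⟨a + N * b, by simp [ha, hb]⟩

theorem convex_heightOne_image {n : ℕ} {P : Set (Fin n → ℝ)} (hP : Convex ℝ P) :
    Convex ℝ (heightOne '' P) := by
  rintro _ ⟨p, hp, rfl⟩ _ ⟨q, hq, rfl⟩ a b ha hb hab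
  refine ⟨a • p + b • q, hP hp hq ha hb hab, ?_⟩
  ext i
  refine Fin.lastCases ?_ (fun i => ?_) i <;> simp [hab]

theorem zero_mem_pyramid {n : ℕ} (P : Set (Fin n → ℝ)) : 0 ∈ pyramid P :=
  subset_convexHull ℝ _ (mem_insert _ _)

theorem heightOne_mem_pyramid {n : ℕ} {P : Set (Fin n → ℝ)} {p : Fin n → ℝ} (hp : p ∈ P) :
    heightOne p ∈ pyramid P :=
  subset_convexHull ℝ _ (mem_insert_of_mem _ ⟨p, hp, rfl⟩)

theorem eq_zero_or_eq_smul_heightOne {n : ℕ} {P : Set (Fin n → ℝ)} (hP : Convex ℝ P)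
    {y : Fin (n + 1) → ℝ} (hy : y ∈ pyramid P) :
    y = 0 ∨ ∃ s : ℝ, 0 ≤ s ∧ s ≤ 1 ∧ ∃ p ∈ P, y = s • heightOne p := by
  rcases P.eq_empty_or_nonempty with rfl | hne
  · left
    simpa [pyramid] using hy
  · right
    change y ∈ convexHull ℝ (insert 0 (heightOne '' P)) at hy
    rw [convexHull_insert (hne.image _), (convex_heightOne_image hP).convexHull_eq,
      mem_convexJoin] at hy
    obtain ⟨x, rfl, _, ⟨p, hp, rfl⟩, a, b, ha, hb, hab, rfl⟩ := hy
    exact ⟨b, hb, by linarith, p, hp, by simp⟩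

theorem last_nonneg_of_mem_pyramid {n : ℕ} {P : Set (Fin n → ℝ)} (hP : Convex ℝ P)
    {y : Fin (n + 1) → ℝ} (hy : y ∈ pyramid P) : 0 ≤ y (Fin.last n) := by
  obtain rfl | ⟨s, hs, -, p, -, rfl⟩ := eq_zero_or_eq_smul_heightOne hP hy
  · simp
  · simpa using hs

theorem eq_zero_of_last_eq_zero {n : ℕ} {P : Set (Fin n → ℝ)} (hP : Convex ℝ P)
    {y : Fin (n + 1) → ℝ} (hy : y ∈ pyramid P) (h0 : y (Fin.last n) = 0) : y = 0 := by
  obtain rfl | ⟨s, hs, -, p, -, rfl⟩ := eq_zero_or_eq_smul_heightOne hP hy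
  · rfl
  · have : s = 0 := by simpa using h0
    simp [this]

theorem zero_mem_extremePoints_pyramid {n : ℕ} {P : Set (Fin n → ℝ)} (hP : Convex ℝ P) :
    0 ∈ (pyramid P).extremePoints ℝ := by
  refine mem_extremePoints.2 ⟨zero_mem_pyramid P, fun x hx y hy h => ?_⟩
  obtain ⟨a, b, ha, hb, -, hab⟩ := h
  have hlast := congrFun hab (Fin.last n)
  simp only [Pi.add_apply, Pi.smul_apply, smul_eq_mul, Pi.zero_apply] at hlast
  have hx0 := last_nonneg_of_mem_pyramid hP hx
  have hy0 := last_nonneg_of_mem_pyramid hP hy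
  have hax := mul_nonneg ha.le hx0
  have hby := mul_nonneg hb.le hy0
  refine ⟨eq_zero_of_last_eq_zero hP hx ?_, eq_zero_of_last_eq_zero hP hy ?_⟩
  · exact (mul_eq_zero.1 (by linarith : a * x (Fin.last n) = 0)).resolve_left ha.ne'
  · exact (mul_eq_zero.1 (by linarith : b * y (Fin.last n) = 0)).resolve_left hb.ne'

theorem eq_zero_or_exists_of_mem_latticePts_pyramid {n : ℕ} {P : Set (Fin n → ℝ)}
    (hP : Convex ℝ P) {y : Fin (n + 1) → ℝ} (hy : y ∈ latticePts (pyramid P)) :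
    y = 0 ∨ ∃ p ∈ latticePts P, y = heightOne p := by
  obtain ⟨hyP, hyL⟩ := hy
  obtain rfl | ⟨s, hs, hs1, p, hp, rfl⟩ := eq_zero_or_eq_smul_heightOne hP hyP
  · exact .inl rfl
  obtain ⟨z, hz⟩ := hyL (Fin.last n)
  have hz' : s = z := by simpa using hz
  have h0 : 0 ≤ z := by exact_mod_cast hz' ▸ hs
  have h1 : z ≤ 1 := by exact_mod_cast hz' ▸ hs1
  obtain rfl | rfl : z = 0 ∨ z = 1 := by omega
  · left
    simp [hz']
  · right
    refine ⟨p, ⟨hp, fun i => ?_⟩, by simp [hz']⟩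
    simpa [hz'] using hyL i.castSucc

theorem isLatticePt_of_mem_extremePoints_pyramid {n : ℕ} {P : Set (Fin n → ℝ)}
    (hP : IsLatticePolytope P) {w : Fin (n + 1) → ℝ} (hw : w ∈ (pyramid P).extremePoints ℝ) :
    IsLatticePt w := by
  obtain ⟨S, hS, rfl⟩ := hP
  have hw' : w ∈ insert 0 (heightOne '' (convexHull ℝ (S : Set (Fin n → ℝ)))) :=
    extremePoints_convexHull_subset hw
  obtain rfl | ⟨v, hv, rfl⟩ := hw'
  · exact isLatticePt_zero
  refine (hS v (extremePoints_convexHull_subset (𝕜 := ℝ) ?_)).heightOne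
  refine mem_extremePoints.2 ⟨hv, fun x hx y hy h => ?_⟩
  obtain ⟨a, b, ha, hb, hab, rfl⟩ := h
  have key := (mem_extremePoints.1 hw).2 _ (heightOne_mem_pyramid hx) _ (heightOne_mem_pyramid hy)
    ⟨a, b, ha, hb, hab, by
      ext i
      refine Fin.lastCases ?_ (fun i => ?_) i <;> simp [hab]⟩
  constructor
  · ext i
    simpa using congrFun key.1 i.castSucc
  · ext i
    simpa using congrFun key.2 i.castSucc

theorem IsNormal.pyramid {n : ℕ} {P : Set (Fin n → ℝ)} (hP : Convex ℝ P) (h : IsNormal P) :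
    IsNormal (pyramid P) := by
  rintro N - _ ⟨⟨q, hq, rfl⟩, hL⟩
  obtain rfl | ⟨s, hs, hs1, p, hp, rfl⟩ := eq_zero_or_eq_smul_heightOne hP hq
  · exact ⟨fun _ => 0, fun _ => ⟨zero_mem_pyramid P, isLatticePt_zero⟩, by simp⟩
  obtain ⟨z, hz⟩ := hL (Fin.last n)
  have hz' : (N : ℝ) * s = z := by simpa using hz
  have h0 : 0 ≤ z := by
    have : (0 : ℝ) ≤ z := hz' ▸ by positivity
    exact_mod_cast this
  lift z to ℕ using h0
  have hzN : z ≤ N := by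
    have : ((z : ℕ) : ℝ) ≤ N := by
      have := mul_le_mul_of_nonneg_left hs1 (Nat.cast_nonneg (α := ℝ) N)
      push_cast at hz'
      linarith
    exact_mod_cast this
  obtain ⟨r, rfl⟩ := Nat.exists_eq_add_of_le hzN
  rcases Nat.eq_zero_or_pos z with rfl | hpos
  · refine ⟨fun _ => 0, fun _ => ⟨zero_mem_pyramid P, isLatticePt_zero⟩, ?_⟩
    simp only [smul_smul, hz']
    simp
  obtain ⟨u, hu, hsum⟩ := h z hpos ((z : ℝ) • p) ⟨⟨p, hp, rfl⟩, fun i => by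
    obtain ⟨c, hc⟩ := hL i.castSucc
    refine ⟨c, ?_⟩
    simp only [smul_smul, hz'] at hc
    simpa using hc⟩
  refine ⟨Fin.append (fun j => heightOne (u j)) (fun _ => 0), fun j => ?_, ?_⟩
  · refine Fin.addCases (fun j => ?_) (fun j => ?_) j
    · rw [Fin.append_left]
      exact ⟨heightOne_mem_pyramid (hu j).1, (hu j).2.heightOne⟩
    · rw [Fin.append_right]
      exact ⟨zero_mem_pyramid P, isLatticePt_zero⟩
  · simp only [smul_smul, hz', Fin.sum_univ_add, Fin.append_left, Fin.append_right,
      Finset.sum_const_zero, add_zero]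
    ext i
    refine Fin.lastCases ?_ (fun i => ?_) i
    · simp
    · simpa using congrFun hsum i

theorem IsNormal.isVeryAmple {n : ℕ} {Q : Set (Fin n → ℝ)} (hQ : Convex ℝ Q) (h : IsNormal Q)
    (hV : ∀ v ∈ Q.extremePoints ℝ, IsLatticePt v) : IsVeryAmple Q := by
  rintro w hw x hx ⟨t, _, ⟨q, hq, rfl⟩, ht, rfl⟩
  rcases ht.eq_or_lt with rfl | htpos
  · exact ⟨0, Fin.elim0, fun j => j.elim0, by simp⟩
  have hN : t ≤ ⌈t⌉₊ := Nat.le_ceil t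
  have hNpos : 0 < ⌈t⌉₊ := Nat.ceil_pos.2 htpos
  generalize ⌈t⌉₊ = N at hN hNpos
  have hNr : (0 : ℝ) < N := by exact_mod_cast hNpos
  have hmem : t • (q - w) + (N : ℝ) • w ∈ (N : ℝ) • Q := by
    refine ⟨(t / N) • q + (1 - t / N) • w, hQ hq hw.1 (by positivity) ?_ (by ring), ?_⟩
    · rw [sub_nonneg, div_le_one hNr]
      exact hN
    · ext i
      simp only [Pi.smul_apply, Pi.add_apply, Pi.sub_apply, smul_eq_mul]
      field_simp
      ring
  obtain ⟨u, hu, hsum⟩ := h N hNpos _ ⟨hmem, hx.add_nsmul (hV w hw) N⟩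
  refine ⟨N, u, hu, ?_⟩
  rw [Finset.sum_sub_distrib, ← hsum]
  simp [Nat.cast_smul_eq_nsmul]

theorem IsVeryAmple.isNormal_of_pyramid {n : ℕ} {P : Set (Fin n → ℝ)} (hP : Convex ℝ P)
    (h : IsVeryAmple (pyramid P)) : IsNormal P := by
  classical
  rintro t - _ ⟨⟨p, hp, rfl⟩, hL⟩
  obtain ⟨m, u, hu, hsum⟩ := h 0 (zero_mem_extremePoints_pyramid hP) ((t : ℝ) • heightOne p)
    (fun i => by
      refine Fin.lastCases ⟨t, by simp⟩ (fun i => ?_) i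
      simpa using hL i)
    ⟨t, _, ⟨_, heightOne_mem_pyramid hp, rfl⟩, by positivity, by simp⟩
  simp only [sub_zero] at hsum
  set s := Finset.univ.filter fun j => u j ≠ 0
  have hs : ∀ j : s, ∃ p ∈ latticePts P, u j = heightOne p := fun j =>
    (eq_zero_or_exists_of_mem_latticePts_pyramid hP (hu j)).resolve_left
      (Finset.mem_filter.1 j.2).2
  choose v hv huv using hs
  have hsum' : (t : ℝ) • heightOne p = ∑ j : s, heightOne (v j) := by
    rw [hsum, ← Finset.sum_filter_ne_zero, ← Finset.sum_coe_sort]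
    exact Finset.sum_congr rfl fun j _ => huv j
  have hcard : s.card = t := by
    have := congrFun hsum' (Fin.last n)
    simp only [Pi.smul_apply, heightOne_last, Finset.sum_apply] at this
    simp at this
    exact_mod_cast this.symm
  let e : Fin t ≃ s := (s.equivFinOfCardEq hcard).symm
  refine ⟨fun j => v (e j), fun j => hv _, ?_⟩
  rw [e.sum_comp v]
  ext i
  simpa using congrFun hsum' i.castSucc

/-- the 1-fold standard pyramid over a lattice polytope `P` is very ample
iff `P` is normal. -/
theorem stmt9 {k : ℕ} (P : Set (Fin k → ℝ)) (hP : IsLatticePolytope P) :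
    IsVeryAmple (pyramid P) ↔ IsNormal P := by
  have hconv : Convex ℝ P := by
    obtain ⟨S, -, rfl⟩ := hP
    exact convex_convexHull ℝ _
  refine ⟨fun h => h.isNormal_of_pyramid hconv, fun h => ?_⟩
  exact (h.pyramid hconv).isVeryAmple (convex_convexHull ℝ _)
    fun _ => isLatticePt_of_mem_extremePoints_pyramid hP
end

section
/- Let P = conv(v_0, …, v_d) ⊂ ℝ^d be a lattice d-simplex, let k ≥ 1 be an integer, and let x ∈ (k+1)P ∩ M be a lattice point whose (unique) barycentric representation x = a_0·v_0 + ⋯ + a_d·v_d with a_i ≥ 0 and a_0 + ⋯ + a_d = k + 1 satisfies a_i < 1 for every i. Then k < d and the point (1−a_0)·v_0 + ⋯ + (1−a_d)·v_d is an interior lattice point of the dilate (d−k)P. -/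
open Set MeasureTheory
open scoped Pointwise

theorem AffineIndependent.sum_smul_mem_interior_convexHull {ι E : Type*} [Fintype ι]
    [NormedAddCommGroup E] [NormedSpace ℝ E] [FiniteDimensional ℝ E] {v : ι → E}
    (hind : AffineIndependent ℝ v) (hcard : Fintype.card ι = Module.finrank ℝ E + 1)
    {w : ι → ℝ} (hw : ∀ i, 0 < w i) (hsum : ∑ i, w i = 1) :
    ∑ i, w i • v i ∈ interior (convexHull ℝ (Set.range v)) := by
  let b : AffineBasis ι ℝ E :=
    ⟨v, hind, hind.affineSpan_eq_top_iff_card_eq_finrank_add_one.2 hcard⟩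
  have hb : interior (convexHull ℝ (Set.range v)) = {x | ∀ i, 0 < b.coord i x} :=
    b.interior_convexHull
  rw [hb]
  intro i
  have hcomb : ∑ i, w i • v i = Finset.univ.affineCombination ℝ b w :=
    (Finset.univ.affineCombination_eq_linear_combination v w hsum).symm
  rw [hcomb, b.coord_apply_combination_of_mem (Finset.mem_univ i) hsum]
  exact hw i

theorem IsLatticePt.sub {n : ℕ} {x y : Fin n → ℝ} (hx : IsLatticePt x) (hy : IsLatticePt y) :
    IsLatticePt (x - y) := by
  intro i
  obtain ⟨p, hp⟩ := hx i
  obtain ⟨q, hq⟩ := hy i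
  exact ⟨p - q, by simp [hp, hq]⟩

theorem IsLatticePt.sum {n : ℕ} {ι : Type*} {s : Finset ι} {x : ι → Fin n → ℝ}
    (hx : ∀ j ∈ s, IsLatticePt (x j)) : IsLatticePt (∑ j ∈ s, x j) := by
  intro i
  choose! z hz using fun j hj => hx j hj i
  refine ⟨∑ j ∈ s, z j, ?_⟩
  rw [Finset.sum_apply, Int.cast_sum]
  exact Finset.sum_congr rfl hz

/-- if all barycentric coordinates of a lattice point `x ∈ (k+1)P` are
`< 1`, then `k < d` and `∑ (1 - aᵢ) vᵢ` is an interior lattice point of `(d-k)P`. -/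
theorem stmt16 {d : ℕ} (v : Fin (d + 1) → Fin d → ℝ)
    (hlat : ∀ i, IsLatticePt (v i)) (hind : AffineIndependent ℝ v)
    (k : ℕ) (hk : 1 ≤ k) (x : Fin d → ℝ) (hxlat : IsLatticePt x)
    (a : Fin (d + 1) → ℝ) (ha0 : ∀ i, 0 ≤ a i) (hasum : ∑ i, a i = (k : ℝ) + 1)
    (hxa : x = ∑ i, a i • v i) (halt : ∀ i, a i < 1) :
    k < d ∧
      (∑ i, (1 - a i) • v i) ∈
        latticePts (interior (((d : ℝ) - (k : ℝ)) • convexHull ℝ (Set.range v))) := by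
  have hpos : ∀ i, 0 < 1 - a i := fun i => sub_pos.2 (halt i)
  have hsum : ∑ i, (1 - a i) = (d : ℝ) - k := by
    simp [Finset.sum_sub_distrib, hasum]
  have hdk : (0 : ℝ) < (d : ℝ) - k :=
    hsum ▸ Finset.sum_pos (fun i _ => hpos i) Finset.univ_nonempty
  refine ⟨by exact_mod_cast sub_pos.1 hdk, ?_, ?_⟩
  · rw [interior_smul₀ hdk.ne', Set.mem_smul_set_iff_inv_smul_mem₀ hdk.ne', Finset.smul_sum]
    simp only [smul_smul]
    refine hind.sum_smul_mem_interior_convexHull (by simp)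
      (fun i => mul_pos (inv_pos.2 hdk) (hpos i)) ?_
    rw [← Finset.mul_sum, hsum, inv_mul_cancel₀ hdk.ne']
  · have hsub : ∑ i, (1 - a i) • v i = ∑ i, v i - x := by
      simp [sub_smul, Finset.sum_sub_distrib, hxa]
    rw [hsub]
    exact (IsLatticePt.sum fun i _ => hlat i).sub hxlat
end
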